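/- arXiv:0807.4308 — 2 statements merged into one kernel-verified Lean document; each statement's English description precedes it below -/
import Mathlib

section
/- Let (B, m) be a Noetherian local ring and let (S₁, m₁) and (S₂, m₂) be regular local subrings of B with mᵢ = Sᵢ ∩ m for i = 1, 2. Let (I_k)_{k≥0} be a Rees family on B with associated subalgebra H ⊆ B[W], and for i = 1, 2 let (J_{i,k})_{k≥0} be a Rees family on Sᵢ with associated subalgebra Hᵢ ⊆ Sᵢ[W], such that J_{i,k}·B ⊆ I_k for all k. Assume for i = 1, 2 that: (i) B is finite and flat as an Sᵢ-module; (ii) mᵢB is a reduction of m; and (iii) H is a finite module over the image of Hᵢ in B[W]. Then inf_{k ≥ 1} ν_{m₁}(J_{1,k})/k = inf_{k ≥ 1} ν_{m₂}(J_{2,k})/k as elements of [0, ∞]. -/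
open scoped ENNReal

/-- The `m`-adic order of an ideal `J` of a local ring `(R, m)`:
`ν(J) = sup {t ∈ ℕ : J ⊆ m^t} ∈ [0, ∞]` (so `ν(0) = ∞`), viewed in `ℝ≥0∞`. -/
noncomputable def mAdicOrder {R : Type*} [CommRing R] [IsLocalRing R] (J : Ideal R) : ℝ≥0∞ :=
  ⨆ t ∈ {t : ℕ | J ≤ IsLocalRing.maximalIdeal R ^ t}, (t : ℝ≥0∞)

/-- A (Noetherian) local ring is regular if its maximal ideal can be generated by
`dim R` elements. -/
def IsRegularLocal (R : Type*) [CommRing R] [IsLocalRing R] : Prop :=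
  IsNoetherianRing R ∧
    ∃ s : Finset R, Ideal.span (↑s : Set R) = IsLocalRing.maximalIdeal R ∧
      (s.card : WithBot (WithTop ℕ)) = ringKrullDim R

section AuxSection

open IsLocalRing

theorem aux_pow_sup {R : Type*} [CommRing R] (X L : Ideal R) (n : ℕ) :
    (X ⊔ L) ^ (n + 1) ≤ X * (X ⊔ L) ^ n ⊔ L ^ (n + 1) := by
  induction n with
  | zero => simp
  | succ n ih =>
    rw [pow_succ' (X ⊔ L) (n + 1), Ideal.sup_mul]
    refine sup_le le_sup_left ?_
    refine (Ideal.mul_mono_right ih).trans ?_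
    rw [Ideal.mul_sup]
    refine sup_le (le_sup_of_le_left ?_) (le_sup_of_le_right ?_)
    · rw [mul_left_comm]
      refine Ideal.mul_mono_right ?_
      rw [pow_succ' (X ⊔ L) n]
      exact Ideal.mul_mono_left le_sup_right
    · rw [pow_succ' L (n + 1)]

theorem aux_sup_pow_sup {R : Type*} [CommRing R] (X L P : Ideal R) (n : ℕ) :
    (X ⊔ L) ^ n ⊔ P ≤ L ^ n ⊔ (P ⊔ X) := by
  cases n with
  | zero => simp
  | succ n =>
    intro z hz
    obtain ⟨u, hu, v, hv, rfl⟩ := Submodule.mem_sup.mp hz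
    obtain ⟨u1, hu1, u2, hu2, rfl⟩ := Submodule.mem_sup.mp (aux_pow_sup X L n hu)
    exact add_mem (add_mem (Ideal.mem_sup_right (Ideal.mem_sup_right ((Ideal.mul_le_left (I := X) (J := (X ⊔ L) ^ n)) hu1)))
      (Ideal.mem_sup_left hu2)) (Ideal.mem_sup_right (Ideal.mem_sup_left hv))

/-- `gr_K (R / P)` is a domain. -/
def AuxGood {R : Type*} [CommRing R] (P K : Ideal R) : Prop :=
  ∀ (s t : ℕ) (a b : R), a ∈ K ^ s ⊔ P → b ∈ K ^ t ⊔ P → a * b ∈ K ^ (s + t + 1) ⊔ P →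
    a ∈ K ^ (s + 1) ⊔ P ∨ b ∈ K ^ (t + 1) ⊔ P

theorem aux_good_colon {R : Type*} [CommRing R] {P L : Ideal R} (h : AuxGood P L) {x : R}
    (hx : x ∉ L ⊔ P) (n : ℕ) (a : R) (ha : x * a ∈ L ^ n ⊔ P) : a ∈ L ^ n ⊔ P := by
  suffices ∀ j ≤ n, a ∈ L ^ j ⊔ P from this n le_rfl
  intro j
  induction j with
  | zero => simp
  | succ j ih =>
    intro hj
    have h0 : x * a ∈ L ^ (0 + j + 1) ⊔ P := by
      rw [zero_add]
      exact sup_le_sup_right (Ideal.pow_le_pow_right hj) P ha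
    rcases h 0 j x a (by simp) (ih (by omega)) h0 with h1 | h1
    · exact absurd (by simpa using h1) hx
    · exact h1

theorem aux_good_step {R : Type*} [CommRing R] {P L : Ideal R} {x : R}
    (hx : x ∉ L ⊔ P) (h1 : AuxGood P L) (h2 : AuxGood (P ⊔ Ideal.span {x}) L) :
    AuxGood P (Ideal.span {x} ⊔ L) := by
  set K := Ideal.span {x} ⊔ L with hK
  have hxK : x ∈ K := Ideal.mem_sup_left (Ideal.mem_span_singleton_self x)
  have hLK : L ≤ K := le_sup_right
  have star : ∀ (n : ℕ) (a : R), x * a ∈ K ^ (n + 1) ⊔ P → a ∈ K ^ n ⊔ P := by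
    intro n a ha
    have ha2 := sup_le_sup_right (aux_pow_sup (Ideal.span {x}) L n) P ha
    rw [← hK, sup_assoc] at ha2
    obtain ⟨u, hu, v, hv, huv⟩ := Submodule.mem_sup.mp ha2
    obtain ⟨a', ha', rfl⟩ := Ideal.mem_span_singleton_mul.mp hu
    have : x * (a - a') ∈ L ^ (n + 1) ⊔ P := by
      have e : x * (a - a') = v := by rw [mul_sub, ← huv]; ring
      rwa [e]
    have h3 := aux_good_colon h1 hx _ _ this
    have h4 : a - a' ∈ K ^ n ⊔ P :=
      sup_le_sup_right ((Ideal.pow_le_pow_right (Nat.le_succ n)).trans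
        (Ideal.pow_right_mono hLK n)) P h3
    have := add_mem h4 (Ideal.mem_sup_left ha' : a' ∈ K ^ n ⊔ P)
    simpa using this
  have xmul : ∀ (n : ℕ) (c : R), c ∈ K ^ n ⊔ P → x * c ∈ K ^ (n + 1) ⊔ P := by
    intro n c hc
    obtain ⟨u, hu, v, hv, rfl⟩ := Submodule.mem_sup.mp hc
    rw [mul_add]
    refine add_mem (Ideal.mem_sup_left ?_) (Ideal.mem_sup_right (P.mul_mem_left _ hv))
    rw [pow_succ']
    exact Ideal.mul_mem_mul hxK hu
  have mulmem : ∀ (i j : ℕ) (c d : R), c ∈ K ^ i ⊔ P → d ∈ K ^ j ⊔ P →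
      c * d ∈ K ^ (i + j) ⊔ P := by
    intro i j c d hc hd
    obtain ⟨u, hu, v, hv, rfl⟩ := Submodule.mem_sup.mp hc
    obtain ⟨u', hu', v', hv', rfl⟩ := Submodule.mem_sup.mp hd
    have e : (u + v) * (u' + v') = u * u' + (v * (u' + v') + u * v') := by ring
    rw [e]
    refine add_mem (Ideal.mem_sup_left ?_) (Ideal.mem_sup_right ?_)
    · rw [pow_add]; exact Ideal.mul_mem_mul hu hu'
    · exact add_mem (P.mul_mem_right _ hv) (P.mul_mem_left _ hv')
  have key : ∀ (s t : ℕ) (a b : R),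
      (∀ s' c, s = s' + 1 → c ∈ K ^ s' ⊔ P → c * b ∈ K ^ (s' + t + 1) ⊔ P →
        c ∈ K ^ (s' + 1) ⊔ P ∨ b ∈ K ^ (t + 1) ⊔ P) →
      a ∈ K ^ s ⊔ P → b ∈ K ^ t ⊔ P → a * b ∈ K ^ (s + t + 1) ⊔ P →
      a ∈ L ^ (s + 1) ⊔ (P ⊔ Ideal.span {x}) →
      a ∈ K ^ (s + 1) ⊔ P ∨ b ∈ K ^ (t + 1) ⊔ P := by
    intro s t a b ih ha hb hab haL
    rw [← sup_assoc] at haL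
    obtain ⟨a', ha', w, hw, rfl⟩ := Submodule.mem_sup.mp haL
    obtain ⟨c, rfl⟩ := Ideal.mem_span_singleton'.mp hw
    rw [mul_comm c x] at *
    have ha'' : a' ∈ K ^ (s + 1) ⊔ P := sup_le_sup_right (Ideal.pow_right_mono hLK _) P ha'
    cases s with
    | zero =>
      left
      exact add_mem ha'' (xmul 0 c (by simp))
    | succ s =>
      have hxc : x * c ∈ K ^ (s + 1) ⊔ P := by
        have := sub_mem ha (sup_le_sup_right (Ideal.pow_le_pow_right (Nat.le_succ (s + 1))) P ha'')
        simpa using this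
      have hc := star _ _ hxc
      have hxcb : x * (c * b) ∈ K ^ (s + t + 1 + 1) ⊔ P := by
        have h5 := mulmem _ _ _ _ ha'' hb
        have e : s + 1 + 1 + t = s + t + 1 + 1 := by ring
        have e' : s + 1 + t + 1 = s + t + 1 + 1 := by ring
        rw [e] at h5
        rw [e'] at hab
        have := sub_mem hab h5
        have e2 : (a' + x * c) * b - a' * b = x * (c * b) := by ring
        rwa [e2] at this
      rcases ih s c rfl hc (star _ _ hxcb) with h | h
      · left; exact add_mem ha'' (xmul _ _ h)
      · right; exact h
  have main : ∀ (n s t : ℕ) (a b : R), s + t = n → a ∈ K ^ s ⊔ P → b ∈ K ^ t ⊔ P →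
      a * b ∈ K ^ (s + t + 1) ⊔ P → a ∈ K ^ (s + 1) ⊔ P ∨ b ∈ K ^ (t + 1) ⊔ P := by
    intro n
    induction n with
    | zero =>
      intro s t a b hst ha hb hab
      have hs : s = 0 := by omega
      have ht : t = 0 := by omega
      rcases h2 s t a b (aux_sup_pow_sup _ _ _ _ ha) (aux_sup_pow_sup _ _ _ _ hb)
        (aux_sup_pow_sup _ _ _ _ hab) with h | h
      · exact key s t a b (by intros; omega) ha hb hab h
      · exact (key t s b a (by intros; omega) hb ha
          (by rwa [mul_comm b a, add_comm t s]) h).symm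
    | succ n ih =>
      intro s t a b hst ha hb hab
      rcases h2 s t a b (aux_sup_pow_sup _ _ _ _ ha) (aux_sup_pow_sup _ _ _ _ hb)
        (aux_sup_pow_sup _ _ _ _ hab) with h | h
      · exact key s t a b (fun s' c hs hc hcb => ih s' t c b (by omega) hc hb hcb) ha hb hab h
      · exact (key t s b a (fun s' c hs hc hcb => ih s' s c a (by omega) hc ha hcb) hb ha
          (by rwa [mul_comm b a, add_comm t s]) h).symm
  intro s t a b
  exact main _ s t a b rfl

theorem aux_good {R : Type*} [CommRing R] [DecidableEq R] (T : Finset R) : ∀ (P : Ideal R),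
    (∀ V ⊆ T, (P ⊔ Ideal.span (V : Set R)).IsPrime ∧
      ∀ x ∈ T, x ∉ V → x ∉ P ⊔ Ideal.span (V : Set R)) →
    AuxGood P (Ideal.span (T : Set R)) := by
  induction T using Finset.induction_on with
  | empty =>
    intro P hP s t a b ha hb hab
    have hp : P.IsPrime := by simpa using (hP ∅ (by simp)).1
    simp only [Finset.coe_empty, Ideal.span_empty, pow_succ, Submodule.mul_bot, bot_sup_eq] at *
    exact hp.mem_or_mem hab
  | insert x T hxT ih =>
    intro P hP
    rw [Finset.coe_insert, Ideal.span_insert]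
    apply aux_good_step
    · rw [sup_comm]
      exact (hP T (Finset.subset_insert _ _)).2 x (Finset.mem_insert_self _ _) hxT
    · apply ih
      intro V hV
      obtain ⟨h1, h2⟩ := hP V (hV.trans (Finset.subset_insert _ _))
      exact ⟨h1, fun y hy => h2 y (Finset.mem_insert_of_mem hy)⟩
    · apply ih
      intro V hV
      obtain ⟨h1, h2⟩ := hP (insert x V) (Finset.insert_subset_insert _ hV)
      rw [Finset.coe_insert, Ideal.span_insert, ← sup_assoc] at h1 h2
      refine ⟨h1, fun y hy hyV => h2 y (Finset.mem_insert_of_mem hy) ?_⟩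
      intro h
      rcases Finset.mem_insert.mp h with rfl | h
      · exact hxT hy
      · exact hyV h

theorem aux_dim_le {R : Type*} [CommRing R] [IsLocalRing R] [IsNoetherianRing R] (t : Finset R)
    (ht : Ideal.span (t : Set R) = maximalIdeal R) : ringKrullDim R ≤ (t.card : WithBot ℕ∞) := by
  refine (ringKrullDim_le_spanFinrank_maximalIdeal R).trans ?_
  rw [← ht]
  have := Submodule.spanFinrank_span_le_ncard_of_finite (R := R) t.finite_toSet
  rw [Set.ncard_coe_finset] at this
  exact Nat.cast_le.mpr this

theorem aux_quot {R : Type*} [CommRing R] [IsLocalRing R] [IsNoetherianRing R] [DecidableEq R]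
    (s U : Finset R) (hs : Ideal.span (s : Set R) = maximalIdeal R)
    (hd : (s.card : WithBot ℕ∞) ≤ ringKrullDim R) (hU : U ⊆ s) :
    ∃ (_ : IsLocalRing (R ⧸ Ideal.span (U : Set R)))
      (t : Finset (R ⧸ Ideal.span (U : Set R))), Ideal.span (t : Set (R ⧸ Ideal.span (U : Set R))) = maximalIdeal (R ⧸ Ideal.span (U : Set R)) ∧
      (t.card : WithBot ℕ∞) ≤ ringKrullDim (R ⧸ Ideal.span (U : Set R)) ∧
      t.card ≤ s.card - U.card := by
  classical
  have hUm : Ideal.span (U : Set R) ≤ maximalIdeal R := by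
    rw [← hs]; exact Ideal.span_mono (by exact_mod_cast hU)
  have hne : Ideal.span (U : Set R) ≠ ⊤ := fun h => by
    rw [h, top_le_iff] at hUm
    exact Ideal.IsPrime.ne_top' hUm
  have hnt : Nontrivial (R ⧸ Ideal.span (U : Set R)) := Ideal.Quotient.nontrivial_iff.mpr hne
  have hloc : IsLocalRing (R ⧸ Ideal.span (U : Set R)) :=
    IsLocalRing.of_surjective' (Ideal.Quotient.mk _) Ideal.Quotient.mk_surjective
  have hcard : ((s \ U).image (Ideal.Quotient.mk (Ideal.span (U : Set R)))).card
      ≤ s.card - U.card := by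
    rw [← Finset.card_sdiff_of_subset hU]; exact Finset.card_image_le
  refine ⟨hloc, (s \ U).image (Ideal.Quotient.mk _), ?_, ?_, hcard⟩
  · rw [← IsLocalRing.map_maximalIdeal_of_surjective (Ideal.Quotient.mk (Ideal.span (U : Set R)))
      Ideal.Quotient.mk_surjective, Finset.coe_image, ← Ideal.map_span, ← hs]
    apply le_antisymm
    · exact Ideal.map_mono (Ideal.span_mono (by simp))
    · have : (s : Set R) = ((s \ U : Finset R) : Set R) ∪ U := by
        rw [← Finset.coe_union, Finset.sdiff_union_of_subset hU]
      rw [this, Ideal.span_union, Ideal.map_sup, Ideal.map_quotient_self, sup_bot_eq]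
  · have h1 := ringKrullDim_le_ringKrullDim_quotient_add_card U (by
      rw [IsLocalRing.ringJacobson_eq_maximalIdeal]
      exact fun y hy => hUm (Ideal.subset_span hy))
    have h2 := hd.trans h1
    have hUs := Finset.card_le_card hU
    have h3 : ((s.card - U.card : ℕ) : WithBot ℕ∞) ≤
        ringKrullDim (R ⧸ Ideal.span (U : Set R)) := by
      have h4 : ((s.card - U.card : ℕ) : WithBot ℕ∞) + (U.card : WithBot ℕ∞) ≤
        ringKrullDim (R ⧸ Ideal.span (U : Set R)) + (U.card : WithBot ℕ∞) := by
        refine le_trans (le_of_eq ?_) h2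
        rw [← Nat.cast_add, Nat.sub_add_cancel hUs]
      exact ENat.WithBot.add_le_add_natCast_right_iff.mp h4
    refine le_trans ?_ h3
    exact_mod_cast hcard

theorem aux_exchange {R : Type*} [CommRing R] [IsLocalRing R] [DecidableEq R]
    (s : Finset R) (hs : Ideal.span (s : Set R) = maximalIdeal R) (x : R)
    (hx : x ∈ maximalIdeal R) (hx2 : x ∉ maximalIdeal R ^ 2) :
    ∃ y ∈ s, Ideal.span ((insert x (s.erase y) : Finset R) : Set R) = maximalIdeal R := by
  rw [← hs] at hx
  obtain ⟨f, -, hf⟩ := Submodule.mem_span_finset.mp hx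
  have : ∃ y ∈ s, f y ∉ maximalIdeal R := by
    by_contra! h
    apply hx2
    rw [← hf, pow_two]
    refine sum_mem fun y hy => Ideal.mul_mem_mul (h y hy) ?_
    rw [← hs]; exact Ideal.subset_span hy
  obtain ⟨y, hy, hfy⟩ := this
  refine ⟨y, hy, le_antisymm ?_ ?_⟩
  · rw [Ideal.span_le, ← hs]
    intro z hz
    rcases Finset.mem_insert.mp hz with rfl | hz
    · exact hx
    · exact Ideal.subset_span (Finset.mem_of_mem_erase hz)
  · rw [← hs, Ideal.span_le]
    intro z hz
    by_cases hzy : z = y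
    · subst hzy
      have hu : IsUnit (f z) := by simpa using hfy
      rw [SetLike.mem_coe, ← Ideal.unit_mul_mem_iff_mem _ hu]
      rw [← Finset.add_sum_erase s _ hy] at hf
      have e : f z * z = x - ∑ a ∈ s.erase z, f a • a := by rw [← hf]; simp
      rw [e]
      refine sub_mem (Ideal.subset_span (by simp)) (sum_mem fun a ha => ?_)
      exact Ideal.mul_mem_left _ _ (Ideal.subset_span (Finset.mem_insert_of_mem ha))
    · exact Ideal.subset_span (Finset.mem_insert_of_mem (Finset.mem_erase.mpr ⟨hzy, hz⟩))

universe u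

theorem aux_domain (n : ℕ) : ∀ {R : Type u} [CommRing R] [IsLocalRing R] [IsNoetherianRing R]
    (s : Finset R), Ideal.span (s : Set R) = maximalIdeal R →
    (s.card : WithBot ℕ∞) ≤ ringKrullDim R → s.card ≤ n → IsDomain R := by
  have base : ∀ {R : Type u} [CommRing R] [IsLocalRing R], maximalIdeal R = ⊥ → IsDomain R := by
    intro R _ _ h
    have := IsLocalRing.isField_iff_maximalIdeal_eq.mpr h
    exact this.isDomain
  induction n with
  | zero =>
    intro R _ _ _ s hs hd hn
    have : s = ∅ := by simpa using hn
    subst this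
    exact base (by rw [← hs]; simp)
  | succ n ih =>
    intro R _ _ _ s hs hd hn
    classical
    by_cases hs0 : s = ∅
    · subst hs0
      exact base (by rw [← hs]; simp)
    have hcpos : 0 < s.card := Finset.card_pos.mpr (Finset.nonempty_iff_ne_empty.mpr hs0)
    have hmb : maximalIdeal R ≠ ⊥ := by
      intro h
      have h1 := aux_dim_le (R := R) ∅ (by simp [h])
      have := hd.trans h1
      have : s.card ≤ 0 := by exact_mod_cast this
      omega
    have hm2 : ¬ maximalIdeal R ≤ maximalIdeal R ^ 2 := by
      intro h
      apply hmb
      refine Submodule.eq_bot_of_le_smul_of_le_jacobson_bot (maximalIdeal R) _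
        (IsNoetherian.noetherian _) ?_ ?_
      · rwa [smul_eq_mul, ← pow_two]
      · exact IsLocalRing.maximalIdeal_le_jacobson _
    have hmin : ∀ q ∈ minimalPrimes R, ¬ maximalIdeal R ≤ q := by
      intro q hq hle
      have : q.IsPrime := hq.1.1
      have e : maximalIdeal R = q := le_antisymm hle (IsLocalRing.le_maximalIdeal this.ne_top)
      rw [← e] at hq
      have h0 := Ideal.height_eq_zero_iff.mpr hq
      have h1 := IsLocalRing.maximalIdeal_height_eq_ringKrullDim (R := R)
      rw [h0] at h1
      rw [← h1] at hd
      have : s.card ≤ 0 := by exact_mod_cast hd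
      omega
    have hfin := minimalPrimes.finite_of_isNoetherianRing R
    have hav : ∃ x ∈ maximalIdeal R, x ∉ maximalIdeal R ^ 2 ∧ ∀ q ∈ minimalPrimes R, x ∉ q := by
      by_contra! hcon
      have := (Ideal.subset_union_prime (s := insert (maximalIdeal R ^ 2) hfin.toFinset)
        (f := fun i => i) (maximalIdeal R ^ 2) (maximalIdeal R ^ 2) (I := maximalIdeal R) ?_).mp ?_
      · obtain ⟨q, hq, hle⟩ := this
        rcases Finset.mem_insert.mp hq with rfl | hq
        · exact hm2 hle
        · exact hmin q (hfin.mem_toFinset.mp hq) hle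
      · intro i hi h1 _
        rcases Finset.mem_insert.mp hi with rfl | hq
        · exact absurd rfl h1
        · exact (hfin.mem_toFinset.mp hq).1.1
      · intro x hx
        simp only [Set.mem_iUnion]
        by_cases hx2 : x ∈ maximalIdeal R ^ 2
        · exact ⟨_, Finset.mem_coe.mpr (Finset.mem_insert_self _ _), hx2⟩
        · obtain ⟨q, hq, hxq⟩ := hcon x hx hx2
          exact ⟨q, Finset.mem_coe.mpr (Finset.mem_insert_of_mem (hfin.mem_toFinset.mpr hq)), hxq⟩
    obtain ⟨x, hxm, hx2, hxq⟩ := hav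
    obtain ⟨y, hy, hsp⟩ := aux_exchange s hs x hxm hx2
    have hc' : (insert x (s.erase y)).card ≤ s.card := by
      refine (Finset.card_insert_le _ _).trans ?_
      rw [Finset.card_erase_of_mem hy]; omega
    obtain ⟨hloc, t, ht1, ht2, ht3⟩ := aux_quot (insert x (s.erase y)) {x} hsp
      (le_trans (by exact_mod_cast hc') hd) (by simp)
    have hdom := ih t ht1 ht2 (by rw [Finset.card_singleton] at ht3; omega)
    have hp : (Ideal.span (({x} : Finset R) : Set R)).IsPrime :=
      (Ideal.Quotient.isDomain_iff_prime _).mp hdom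
    rw [Finset.coe_singleton] at hp
    obtain ⟨q, hq, hqx⟩ := Ideal.exists_minimalPrimes_le (I := (⊥ : Ideal R))
      (J := Ideal.span {x}) bot_le
    have hqp : q.IsPrime := hq.1.1
    have hqb : q = ⊥ := by
      refine Submodule.eq_bot_of_le_smul_of_le_jacobson_bot (maximalIdeal R) _
        (IsNoetherian.noetherian _) ?_ (IsLocalRing.maximalIdeal_le_jacobson _)
      intro z hz
      obtain ⟨r, rfl⟩ := Ideal.mem_span_singleton'.mp (hqx hz)
      have hr : r ∈ q := (hqp.mem_or_mem hz).resolve_right (hxq q hq)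
      rw [mul_comm]
      exact Ideal.mul_mem_mul hxm hr
    subst hqb
    exact IsDomain.of_bot_isPrime R

theorem aux_reg_good {R : Type*} [CommRing R] [IsLocalRing R] (hR : IsRegularLocal R) :
    AuxGood ⊥ (maximalIdeal R) := by
  classical
  obtain ⟨hN, s, hs, hd⟩ := hR
  have hd' : (s.card : WithBot ℕ∞) = ringKrullDim R := hd
  rw [← hs]
  apply aux_good
  intro V hV
  rw [bot_sup_eq]
  constructor
  · obtain ⟨hloc, t, ht1, ht2, -⟩ := aux_quot s V hs hd'.le hV
    exact (Ideal.Quotient.isDomain_iff_prime _).mp (aux_domain _ t ht1 ht2 le_rfl)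
  · intro x hx hxV hmem
    have hsub : V ⊆ s.erase x := fun z hz =>
      Finset.mem_erase.mpr ⟨fun h => hxV (h ▸ hz), hV hz⟩
    have : Ideal.span ((s.erase x : Finset R) : Set R) = maximalIdeal R := by
      rw [← hs]
      refine le_antisymm (Ideal.span_mono (by exact_mod_cast Finset.erase_subset x s)) ?_
      rw [Ideal.span_le]
      intro z hz
      by_cases hzx : z = x
      · subst hzx
        exact Ideal.span_mono (by exact_mod_cast hsub) hmem
      · exact Ideal.subset_span (Finset.mem_erase.mpr ⟨hzx, hz⟩)
    have h1 := aux_dim_le _ this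
    rw [← hd'] at h1
    have h2 : s.card ≤ (s.erase x).card := Nat.cast_le.mp h1
    have h3 := Finset.card_erase_lt_of_mem hx
    omega

theorem aux_reg_pow {R : Type*} [CommRing R] [IsLocalRing R] (hR : IsRegularLocal R) (s : ℕ)
    (y : R) (h1 : y ∈ maximalIdeal R ^ s) (h2 : y ∉ maximalIdeal R ^ (s + 1)) (N : ℕ) :
    y ^ N ∉ maximalIdeal R ^ (N * s + 1) := by
  induction N with
  | zero =>
    rw [pow_zero, zero_mul, zero_add, pow_one]
    exact fun h => Ideal.IsPrime.ne_top' ((Ideal.eq_top_iff_one _).mpr h)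
  | succ N ih =>
    intro h
    have hg := aux_reg_good hR (N * s) s (y ^ N) y
    simp only [sup_bot_eq] at hg
    have hy : y ^ N ∈ maximalIdeal R ^ (N * s) := by
      rw [mul_comm, pow_mul]; exact Ideal.pow_mem_pow h1 N
    rcases hg hy h1 (by rw [← pow_succ]; convert! h using 2; ring) with h | h
    · exact ih h
    · exact h2 h

theorem aux_integral {B : Type*} [CommRing B] (m : Ideal B) (y : B) (c : ℝ) (hc : 0 ≤ c) (r : ℕ)
    (a : ℕ → B) (ha : ∀ i, ∃ t : ℕ, a i ∈ m ^ t ∧ c * ((r : ℝ) - i) ≤ t)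
    (heq : y ^ r = ∑ i ∈ Finset.range r, a i * y ^ i) (N : ℕ) :
    y ^ N ∈ m ^ ⌈c * N - c * r⌉₊ := by
  induction N using Nat.strong_induction_on with
  | _ N ih =>
    by_cases hN : N < r
    · have : ⌈c * N - c * r⌉₊ = 0 := by
        rw [Nat.ceil_eq_zero]
        have : (N : ℝ) ≤ r := by exact_mod_cast hN.le
        nlinarith
      rw [this]; simp
    · have hN : r ≤ N := not_lt.mp hN
      have e : y ^ N = ∑ i ∈ Finset.range r, a i * y ^ (N - r + i) := by
        rw [← Nat.sub_add_cancel hN, pow_add, heq, Finset.mul_sum]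
        refine Finset.sum_congr rfl fun i _ => ?_
        rw [Nat.sub_add_cancel hN, pow_add]; ring
      rw [e]
      refine sum_mem fun i hi => ?_
      have hi : i < r := Finset.mem_range.mp hi
      obtain ⟨t, ht, hct⟩ := ha i
      have h1 := Ideal.mul_mem_mul ht (ih (N - r + i) (by omega))
      rw [← pow_add] at h1
      refine Ideal.pow_le_pow_right ?_ h1
      rw [Nat.ceil_le]
      push_cast [Nat.cast_sub hN]
      have h2 := Nat.le_ceil (c * ((N : ℝ) - r + i) - c * r)
      nlinarith

theorem aux_eqn {B : Type*} [CommRing B] (S : Subring B)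
    (H : Subalgebra B (Polynomial B)) (J : ℕ → Ideal ↥S)
    (H₁ : Subalgebra ↥S (Polynomial ↥S)) (hH₁ : ∀ p, p ∈ H₁ ↔ ∀ m : ℕ, p.coeff m ∈ J m)
    (him : H₁.toSubring.map (Polynomial.mapRingHom (algebraMap ↥S B)) ≤ H.toSubring)
    (hfin : RingHom.Finite (Subring.inclusion him)) (k : ℕ) (y : B)
    (hy : Polynomial.monomial k y ∈ H) :
    ∃ (r : ℕ) (a : ℕ → B), (∀ i < r, ∃ z ∈ J (k * (r - i)), a i = algebraMap ↥S B z) ∧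
      y ^ r = ∑ i ∈ Finset.range r, a i * y ^ i := by
  obtain ⟨p, hp, hev⟩ := hfin.to_isIntegral ⟨Polynomial.monomial k y, hy⟩
  rw [Polynomial.eval₂_eq_sum_range, Finset.sum_range_succ, hp.coeff_natDegree] at hev
  have hev2 := congrArg (fun z : H.toSubring => (z : Polynomial B).coeff (k * p.natDegree)) hev
  have hq : ∀ i, ∃ q ∈ H₁, Polynomial.map (algebraMap ↥S B) q = (p.coeff i : Polynomial B) := by
    intro i
    obtain ⟨q, hq, hq2⟩ := (p.coeff i).2
    exact ⟨q, hq, hq2⟩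
  choose q hqH hqe using hq
  refine ⟨p.natDegree, fun i => - algebraMap ↥S B ((q i).coeff (k * (p.natDegree - i))), ?_, ?_⟩
  · intro i _
    exact ⟨-(q i).coeff (k * (p.natDegree - i)), neg_mem ((hH₁ _).mp (hqH i) _), by simp⟩
  · simp only [map_one, one_mul] at hev2
    push_cast at hev2
    simp only [Polynomial.coeff_add, Polynomial.finsetSum_coeff, Polynomial.monomial_pow] at hev2
    have h3 : ∀ i ∈ Finset.range p.natDegree,
        ((Subring.inclusion him (p.coeff i) : Polynomial B) *
          Polynomial.monomial (k * i) (y ^ i)).coeff (k * p.natDegree) =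
        algebraMap ↥S B ((q i).coeff (k * (p.natDegree - i))) * y ^ i := by
      intro i hi
      have hi := (Finset.mem_range.mp hi).le
      have e : k * p.natDegree = k * (p.natDegree - i) + k * i := by
        rw [← mul_add, Nat.sub_add_cancel hi]
      rw [e, Polynomial.coeff_mul_monomial, Subring.coe_inclusion, ← hqe, Polynomial.coeff_map]
    rw [Finset.sum_congr rfl h3] at hev2
    simp only [Polynomial.coeff_monomial, if_true] at hev2
    simp only [neg_mul, Finset.sum_neg_distrib]
    rw [eq_neg_iff_add_eq_zero, add_comm]
    simpa using hev2

theorem aux_reduction {B : Type*} [CommRing B] (m n : Ideal B) (t : ℕ)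
    (h : m ^ (t + 1) = n * m ^ t) (j : ℕ) : m ^ (t + j) ≤ n ^ j := by
  suffices m ^ (t + j) = n ^ j * m ^ t from this ▸ Ideal.mul_le_left
  induction j with
  | zero => simp
  | succ j ih => rw [← add_assoc, pow_succ, ih, mul_assoc, ← pow_succ, h, ← mul_assoc, ← pow_succ]

theorem aux_descend {B : Type*} [CommRing B] [IsLocalRing B] (S : Subring B) [IsLocalRing ↥S]
    (hm : maximalIdeal ↥S = Ideal.comap (algebraMap ↥S B) (maximalIdeal B))
    (hflat : Module.Flat ↥S B) (t : ℕ)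
    (hred : maximalIdeal B ^ (t + 1) =
      Ideal.map (algebraMap ↥S B) (maximalIdeal ↥S) * maximalIdeal B ^ t)
    (j : ℕ) (y : ↥S) (hy : algebraMap ↥S B y ∈ maximalIdeal B ^ (t + j)) :
    y ∈ maximalIdeal ↥S ^ j := by
  have hloc : IsLocalHom (algebraMap ↥S B) := by
    constructor
    intro a ha
    by_contra hna
    have : a ∈ maximalIdeal ↥S := hna
    rw [hm] at this
    exact this ha
  have hff : Module.FaithfullyFlat ↥S B := Module.FaithfullyFlat.of_flat_of_isLocalHom
  have h1 := aux_reduction _ _ t hred j hy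
  rw [← Ideal.map_pow] at h1
  rw [← Ideal.comap_map_eq_self_of_faithfullyFlat (B := B) (maximalIdeal ↥S ^ j)]
  exact h1

theorem aux_half {B : Type*} [CommRing B] [IsLocalRing B]
    (S₁ S₂ : Subring B) [IsLocalRing ↥S₁] [IsLocalRing ↥S₂]
    (hreg₂ : IsRegularLocal ↥S₂)
    (hm₁ : maximalIdeal ↥S₁ = Ideal.comap (algebraMap ↥S₁ B) (maximalIdeal B))
    (hm₂ : maximalIdeal ↥S₂ = Ideal.comap (algebraMap ↥S₂ B) (maximalIdeal B))
    (I : ℕ → Ideal B)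
    (H : Subalgebra B (Polynomial B)) (hH : ∀ p, p ∈ H ↔ ∀ m : ℕ, p.coeff m ∈ I m)
    (J₁ : ℕ → Ideal ↥S₁) (J₂ : ℕ → Ideal ↥S₂)
    (H₁ : Subalgebra ↥S₁ (Polynomial ↥S₁)) (hH₁ : ∀ p, p ∈ H₁ ↔ ∀ m : ℕ, p.coeff m ∈ J₁ m)
    (hJI₂ : ∀ m : ℕ, Ideal.map (algebraMap ↥S₂ B) (J₂ m) ≤ I m)
    (hflat₂ : Module.Flat ↥S₂ B)
    (hred₂ : ∃ t : ℕ, maximalIdeal B ^ (t + 1) =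
      Ideal.map (algebraMap ↥S₂ B) (maximalIdeal ↥S₂) * maximalIdeal B ^ t)
    (him₁ : H₁.toSubring.map (Polynomial.mapRingHom (algebraMap ↥S₁ B)) ≤ H.toSubring)
    (hHfin₁ : RingHom.Finite (Subring.inclusion him₁)) :
    (⨅ k : {k : ℕ // 1 ≤ k}, mAdicOrder (J₁ k) / ((k : ℕ) : ℝ≥0∞)) ≤
      ⨅ k : {k : ℕ // 1 ≤ k}, mAdicOrder (J₂ k) / ((k : ℕ) : ℝ≥0∞) := by
  refine ENNReal.le_of_forall_nnreal_lt fun r hr => le_iInf fun ⟨k, hk⟩ => ?_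
  have hA : ∀ j : ℕ, ∃ t : ℕ, J₁ j ≤ maximalIdeal ↥S₁ ^ t ∧ (r : ℝ) * j ≤ t := by
    intro j
    by_cases hj : j = 0
    · exact ⟨0, by simp, by simp [hj]⟩
    have h1 := hr.trans_le (iInf_le _ (⟨j, by omega⟩ : {k : ℕ // 1 ≤ k}))
    have h2 : (r : ℝ≥0∞) * j < mAdicOrder (J₁ j) := by
      refine (ENNReal.lt_div_iff_mul_lt (Or.inl ?_) (Or.inl ?_)).mp h1
      · exact_mod_cast hj
      · exact ENNReal.natCast_ne_top j
    obtain ⟨t, ht⟩ := lt_iSup_iff.mp h2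
    obtain ⟨ht1, ht2⟩ := lt_iSup_iff.mp ht
    refine ⟨t, ht1, ?_⟩
    have h3 : r * j < (t : NNReal) := by exact_mod_cast ht2
    exact_mod_cast h3.le
  set c : ℝ := r * k with hcdef
  have hc : 0 ≤ c := by positivity
  rw [ENNReal.le_div_iff_mul_le (Or.inl (by simp; omega)) (Or.inl (ENNReal.natCast_ne_top k))]
  have hmain : J₂ k ≤ maximalIdeal ↥S₂ ^ ⌈c⌉₊ := by
    intro y hy
    by_contra hny
    classical
    have hex : ∃ n, y ∉ maximalIdeal ↥S₂ ^ n := ⟨_, hny⟩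
    obtain ⟨s, hs⟩ : ∃ s, Nat.find hex = s + 1 := by
      refine Nat.exists_eq_succ_of_ne_zero fun h => ?_
      have := Nat.find_spec hex
      rw [h] at this
      simp at this
    have hs1 : y ∉ maximalIdeal ↥S₂ ^ (s + 1) := hs ▸ Nat.find_spec hex
    have hs2 : y ∈ maximalIdeal ↥S₂ ^ s := not_not.mp (Nat.find_min hex (by omega))
    have hsc : s < ⌈c⌉₊ := by
      have := Nat.find_min' hex hny
      omega
    rw [Nat.lt_ceil] at hsc
    have hyI : algebraMap ↥S₂ B y ∈ I k := hJI₂ k (Ideal.mem_map_of_mem _ hy)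
    have hyH : Polynomial.monomial k (algebraMap ↥S₂ B y) ∈ H := by
      rw [hH]
      intro m
      rw [Polynomial.coeff_monomial]
      split_ifs with h
      · exact h ▸ hyI
      · exact zero_mem _
    obtain ⟨d, a, ha, heq⟩ := aux_eqn S₁ H J₁ H₁ hH₁ him₁ hHfin₁ k _ hyH
    have hS₁ : ∀ t : ℕ, ∀ z ∈ maximalIdeal ↥S₁ ^ t, algebraMap ↥S₁ B z ∈ maximalIdeal B ^ t := by
      intro t z hz
      have h1 : Ideal.map (algebraMap ↥S₁ B) (maximalIdeal ↥S₁) ≤ maximalIdeal B :=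
        Ideal.map_le_iff_le_comap.mpr hm₁.le
      have h2 := Ideal.mem_map_of_mem (algebraMap ↥S₁ B) hz
      rw [Ideal.map_pow] at h2
      exact Ideal.pow_right_mono h1 t h2
    have hpow := aux_integral (maximalIdeal B) (algebraMap ↥S₂ B y) c hc d
      (fun i => if i < d then a i else 0) (by
        intro i
        by_cases hi : i < d
        · obtain ⟨z, hz, hza⟩ := ha i hi
          obtain ⟨t, ht1, ht2⟩ := hA (k * (d - i))
          refine ⟨t, ?_, ?_⟩
          · simp only [hi, if_true, hza]
            exact hS₁ t z (ht1 hz)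
          · refine le_trans (le_of_eq ?_) ht2
            push_cast [Nat.cast_sub hi.le]
            rw [hcdef]; ring
        · refine ⟨0, by simp, ?_⟩
          have : (d : ℝ) ≤ i := by exact_mod_cast not_lt.mp hi
          simp only [Nat.cast_zero]
          nlinarith) (by
        rw [heq]
        refine Finset.sum_congr rfl fun i hi => ?_
        rw [if_pos (Finset.mem_range.mp hi)])
    obtain ⟨t, ht⟩ := hred₂
    obtain ⟨N, hN⟩ := exists_nat_gt ((c * d + t + 1) / (c - s))
    rw [div_lt_iff₀ (by linarith)] at hN
    have h5 := hpow N
    rw [← map_pow] at h5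
    apply aux_reg_pow hreg₂ s y hs2 hs1 N
    apply aux_descend S₂ hm₂ hflat₂ t ht
    refine Ideal.pow_le_pow_right ?_ h5
    have h6 := Nat.le_ceil (c * N - c * d)
    have h7 : ((t + (N * s + 1) : ℕ) : ℝ) ≤ (⌈c * N - c * d⌉₊ : ℕ) := by
      push_cast
      nlinarith
    exact_mod_cast h7
  have h8 : ((⌈c⌉₊ : ℕ) : ℝ≥0∞) ≤ mAdicOrder (J₂ k) :=
    le_iSup₂_of_le (f := fun (t : ℕ) (_ : t ∈ {t : ℕ | J₂ k ≤ maximalIdeal ↥S₂ ^ t}) =>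
      (t : ℝ≥0∞)) ⌈c⌉₊ hmain le_rfl
  refine le_trans ?_ h8
  have h9 : r * (k : NNReal) ≤ ((⌈c⌉₊ : ℕ) : NNReal) := by
    rw [← NNReal.coe_le_coe]
    push_cast
    exact Nat.le_ceil c
  exact_mod_cast h9

end AuxSection

/-- Let `(B, m)` be a Noetherian local ring, `(S₁, m₁)`, `(S₂, m₂)` regular
local subrings of `B` with `mᵢ = Sᵢ ∩ m`.  Let `(I_k)` be a Rees family on `B` with
associated subalgebra `H ⊆ B[W]`, and for `i = 1, 2` let `(J_{i,k})` be a Rees family on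
`Sᵢ` with associated subalgebra `Hᵢ ⊆ Sᵢ[W]` such that `J_{i,k}·B ⊆ I_k` for all `k`.
Assume that (i) `B` is finite and flat over `Sᵢ`, (ii) `mᵢB` is a reduction of `m`, and
(iii) `H` is a finite module over the image of `Hᵢ` in `B[W]`.  Then
`inf_{k ≥ 1} ν_{m₁}(J_{1,k})/k = inf_{k ≥ 1} ν_{m₂}(J_{2,k})/k` in `[0, ∞]`. -/
theorem ord_elimination_independent_of_projection {B : Type*} [CommRing B] [IsLocalRing B]
    [IsNoetherianRing B] (S₁ S₂ : Subring B) [IsLocalRing ↥S₁] [IsLocalRing ↥S₂]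
    (hreg₁ : IsRegularLocal ↥S₁) (hreg₂ : IsRegularLocal ↥S₂)
    (hm₁ : IsLocalRing.maximalIdeal ↥S₁ =
      Ideal.comap (algebraMap ↥S₁ B) (IsLocalRing.maximalIdeal B))
    (hm₂ : IsLocalRing.maximalIdeal ↥S₂ =
      Ideal.comap (algebraMap ↥S₂ B) (IsLocalRing.maximalIdeal B))
    (I : ℕ → Ideal B) (hI0 : I 0 = ⊤) (hImul : ∀ k l : ℕ, I k * I l ≤ I (k + l))
    (H : Subalgebra B (Polynomial B)) (hH : ∀ p, p ∈ H ↔ ∀ m : ℕ, p.coeff m ∈ I m)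
    (J₁ : ℕ → Ideal ↥S₁) (hJ₁0 : J₁ 0 = ⊤) (hJ₁mul : ∀ k l : ℕ, J₁ k * J₁ l ≤ J₁ (k + l))
    (J₂ : ℕ → Ideal ↥S₂) (hJ₂0 : J₂ 0 = ⊤) (hJ₂mul : ∀ k l : ℕ, J₂ k * J₂ l ≤ J₂ (k + l))
    (H₁ : Subalgebra ↥S₁ (Polynomial ↥S₁)) (hH₁ : ∀ p, p ∈ H₁ ↔ ∀ m : ℕ, p.coeff m ∈ J₁ m)
    (H₂ : Subalgebra ↥S₂ (Polynomial ↥S₂)) (hH₂ : ∀ p, p ∈ H₂ ↔ ∀ m : ℕ, p.coeff m ∈ J₂ m)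
    (hJI₁ : ∀ m : ℕ, Ideal.map (algebraMap ↥S₁ B) (J₁ m) ≤ I m)
    (hJI₂ : ∀ m : ℕ, Ideal.map (algebraMap ↥S₂ B) (J₂ m) ≤ I m)
    -- (i) `B` is finite and flat over `Sᵢ`
    (hfin₁ : Module.Finite ↥S₁ B) (hflat₁ : Module.Flat ↥S₁ B)
    (hfin₂ : Module.Finite ↥S₂ B) (hflat₂ : Module.Flat ↥S₂ B)
    -- (ii) `mᵢB` is a reduction of `m`
    (hred₁ : ∃ t : ℕ, IsLocalRing.maximalIdeal B ^ (t + 1) =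
      Ideal.map (algebraMap ↥S₁ B) (IsLocalRing.maximalIdeal ↥S₁) *
        IsLocalRing.maximalIdeal B ^ t)
    (hred₂ : ∃ t : ℕ, IsLocalRing.maximalIdeal B ^ (t + 1) =
      Ideal.map (algebraMap ↥S₂ B) (IsLocalRing.maximalIdeal ↥S₂) *
        IsLocalRing.maximalIdeal B ^ t)
    -- (iii) `H` is a finite module over the image of `Hᵢ` in `B[W]`
    (him₁ : H₁.toSubring.map (Polynomial.mapRingHom (algebraMap ↥S₁ B)) ≤ H.toSubring)
    (him₂ : H₂.toSubring.map (Polynomial.mapRingHom (algebraMap ↥S₂ B)) ≤ H.toSubring)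
    (hHfin₁ : RingHom.Finite (Subring.inclusion him₁))
    (hHfin₂ : RingHom.Finite (Subring.inclusion him₂)) :
    (⨅ k : {k : ℕ // 1 ≤ k}, mAdicOrder (J₁ k) / ((k : ℕ) : ℝ≥0∞)) =
      ⨅ k : {k : ℕ // 1 ≤ k}, mAdicOrder (J₂ k) / ((k : ℕ) : ℝ≥0∞) := by
  exact le_antisymm
    (aux_half S₁ S₂ hreg₂ hm₁ hm₂ I H hH J₁ J₂ H₁ hH₁ hJI₂ hflat₂ hred₂ him₁ hHfin₁)
    (aux_half S₂ S₁ hreg₁ hm₂ hm₁ I H hH J₂ J₁ H₂ hH₂ hJI₁ hflat₁ hred₁ him₂ hHfin₂)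
end

section
/- Let (R, m) be a regular local ring, and let (I¹_n)_{n≥0} and (I²_n)_{n≥0} be Rees families on R with I¹_n ⊆ I²_n for all n, with associated subalgebras G₁ ⊆ G₂ of R[W]. Assume that every element of G₂ is integral over G₁, and that ν(I¹_n) ≥ n for every n (i.e., the closed point lies in the singular locus). Then inf_{n ≥ 1} ν(I¹_n)/n = inf_{n ≥ 1} ν(I²_n)/n as elements of [0, ∞]; that is, two Rees algebras with the same integral closure have the same order at any singular point. -/
open scoped ENNReal

open IsLocalRing in
lemma aux_aeval_mul {ι R A : Type*} [CommRing R] [CommRing A] [Algebra R A]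
    {F : MvPolynomial ι R} {n : ℕ} (hF : F.IsHomogeneous n) (r : A) (w : ι → A) :
    MvPolynomial.aeval (fun i => r * w i) F = r ^ n * MvPolynomial.aeval w F := by
  simp only [MvPolynomial.aeval_def, MvPolynomial.eval₂_eq, Finset.mul_sum]
  refine Finset.sum_congr rfl fun d hd => ?_
  have h := hF (MvPolynomial.mem_support_iff.mp hd)
  simp only [Finsupp.weight_apply, Pi.one_apply, smul_eq_mul, mul_one, Finsupp.sum] at h
  simp only [mul_pow, Finset.prod_mul_distrib, Finset.prod_pow_eq_pow_sum, h]
  ring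

open IsLocalRing in
lemma aux_key {ι R : Type*} [Fintype ι] [CommRing R] [IsLocalRing R] [IsNoetherianRing R]
    (x : ι → R) (hx : Ideal.span (Set.range x) = maximalIdeal R)
    (hd : (Fintype.card ι : ℕ∞) = (maximalIdeal R).height)
    {F G : MvPolynomial ι R} {n : ℕ} (hF : F.IsHomogeneous n) (hG : G.IsHomogeneous (n + 1))
    (hFG : MvPolynomial.eval x F = MvPolynomial.eval x G) :
    MvPolynomial.map (residue R) F = 0 := by
  classical
  rcases isEmpty_or_nonempty ι with hι | ⟨⟨i₀⟩⟩
  · have hG' : MvPolynomial.eval x G ∈ maximalIdeal R := by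
      have : MvPolynomial.eval x G ∈ Ideal.span (Set.range x) ^ (n + 1) :=
        (Ideal.mem_span_pow_iff_exists_isHomogeneous x _).2 ⟨G, hG, rfl⟩
      rw [hx] at this
      exact Ideal.pow_le_self (Nat.succ_ne_zero n) this
    rw [MvPolynomial.eq_C_of_isEmpty F] at hFG ⊢
    rw [← hFG] at hG'
    simp only [MvPolynomial.eval_C] at hG'
    rw [MvPolynomial.map_C, (residue_eq_zero_iff _).2 hG', map_zero]
  by_contra hne
  let φ : Polynomial R →+* Polynomial (ResidueField R) := Polynomial.mapRingHom (residue R)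
  have hφs : Function.Surjective φ := Polynomial.map_surjective _ residue_surjective
  have hker : RingHom.ker φ = (maximalIdeal R).map Polynomial.C := by
    rw [Polynomial.ker_mapRingHom, ker_residue]
  obtain ⟨v, hv⟩ : ∃ v : ι → Polynomial (ResidueField R),
      v i₀ * MvPolynomial.eval v (MvPolynomial.map Polynomial.C
        (MvPolynomial.map (residue R) F)) ≠ 0 := by
    by_contra! hcon
    have h0 : (MvPolynomial.X i₀ * MvPolynomial.map Polynomial.C
        (MvPolynomial.map (residue R) F) : MvPolynomial ι (Polynomial (ResidueField R))) = 0 := by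
      apply MvPolynomial.funext
      intro v
      simpa using hcon v
    rcases mul_eq_zero.1 h0 with h | h
    · exact MvPolynomial.X_ne_zero _ h
    · exact hne (MvPolynomial.map_injective _ Polynomial.C_injective (by simpa using h))
  choose w hw using fun i => hφs (v i)
  have hwF : φ (MvPolynomial.aeval w F) = MvPolynomial.eval v (MvPolynomial.map Polynomial.C
        (MvPolynomial.map (residue R) F)) := by
    rw [MvPolynomial.map_map, MvPolynomial.eval_map, MvPolynomial.aeval_def,
      MvPolynomial.hom_eval₂]
    congr 1
    · ext a; simp [φ]
    · funext i; exact hw i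
  set M := (maximalIdeal R).map (Polynomial.C : R →+* Polynomial R) with hM
  have hMp : M.IsPrime := by rw [← hker]; exact RingHom.ker_isPrime φ
  have hxM : ∀ i, Polynomial.C (x i) ∈ M := fun i =>
    Ideal.mem_map_of_mem _ (hx ▸ Ideal.subset_span ⟨i, rfl⟩)
  let y : ι → Polynomial R := fun i => w i₀ * Polynomial.C (x i) - w i * Polynomial.C (x i₀)
  let s : Finset (Polynomial R) := (Finset.univ.erase i₀).image y
  have hyi : ∀ P : Ideal (Polynomial R), Ideal.span (s : Set (Polynomial R)) ≤ P →
      ∀ i, y i ∈ P := by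
    intro P hP i
    by_cases hi : i = i₀
    · subst hi; simp [y]
    · exact hP (Ideal.subset_span (by
        simp only [s, Finset.coe_image]
        exact ⟨i, by simp [hi], rfl⟩))
  have hmin : M ∈ (Ideal.span (s : Set (Polynomial R))).minimalPrimes := by
    refine ⟨⟨hMp, ?_⟩, ?_⟩
    · rw [Ideal.span_le]
      intro z hz
      simp only [s, Finset.coe_image] at hz
      obtain ⟨i, -, rfl⟩ := hz
      exact M.sub_mem (M.mul_mem_left _ (hxM _)) (M.mul_mem_left _ (hxM _))
    · rintro P ⟨hPp, hPs⟩ hPM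
      have hy := hyi P hPs
      let π := Ideal.Quotient.mk P
      have hrel : ∀ i, π (w i₀) * π (Polynomial.C (x i)) =
          π (Polynomial.C (x i₀)) * π (w i) := by
        intro i
        have := Ideal.Quotient.eq_zero_iff_mem.2 (hy i)
        simp only [y, map_sub, map_mul, sub_eq_zero] at this
        rw [this, mul_comm]
      have hhom : ∀ (H : MvPolynomial ι R) (k : ℕ), H.IsHomogeneous k →
          π (w i₀) ^ k * π (Polynomial.C (MvPolynomial.eval x H)) =
          π (Polynomial.C (x i₀)) ^ k * π (MvPolynomial.aeval w H) := by
        intro H k hH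
        have e1 : π (Polynomial.C (MvPolynomial.eval x H)) =
            MvPolynomial.aeval (fun i => π (Polynomial.C (x i))) H := by
          rw [MvPolynomial.aeval_def, MvPolynomial.eval, MvPolynomial.coe_eval₂Hom,
            MvPolynomial.hom_eval₂, MvPolynomial.hom_eval₂]
          rfl
        have e2 : π (MvPolynomial.aeval w H) = MvPolynomial.aeval (fun i => π (w i)) H := by
          rw [MvPolynomial.aeval_def, MvPolynomial.aeval_def, MvPolynomial.hom_eval₂]
          rfl
        rw [e1, e2, ← aux_aeval_mul hH, ← aux_aeval_mul hH]
        simp only [hrel]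
      have hx0 : Polynomial.C (x i₀) ∈ P := by
        by_contra hx0
        have hx0' : π (Polynomial.C (x i₀)) ≠ 0 := fun h =>
          hx0 (Ideal.Quotient.eq_zero_iff_mem.1 h)
        have h1 := hhom F n hF
        have h2 := hhom G (n + 1) hG
        rw [← hFG] at h2
        have h3 : π (Polynomial.C (x i₀)) ^ n * π (w i₀ * MvPolynomial.aeval w F -
            Polynomial.C (x i₀) * MvPolynomial.aeval w G) = 0 := by
          rw [map_sub, map_mul, map_mul]
          linear_combination h2 - π (w i₀) * h1
        have h4 := (mul_eq_zero.1 h3).resolve_left (pow_ne_zero _ hx0')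
        have h5 := hPM (Ideal.Quotient.eq_zero_iff_mem.1 h4)
        have h6 : w i₀ * MvPolynomial.aeval w F ∈ M := by
          have := M.add_mem h5 (M.mul_mem_right (MvPolynomial.aeval w G) (hxM i₀))
          simpa using this
        rw [← hker, RingHom.mem_ker, map_mul, hwF, hw] at h6
        exact hv h6
      have hw0 : w i₀ ∉ P := by
        intro h
        have := hPM h
        rw [← hker, RingHom.mem_ker, hw] at this
        exact hv (by rw [this, zero_mul])
      rw [hM, ← hx, Ideal.map_span, Ideal.span_le]
      rintro _ ⟨_, ⟨i, rfl⟩, rfl⟩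
      have : w i₀ * Polynomial.C (x i) ∈ P := by
        have := P.add_mem (hy i) (P.mul_mem_left (w i) hx0)
        simpa [y] using this
      exact (hPp.mem_or_mem this).resolve_left hw0
  have hle := Ideal.height_le_card_of_mem_minimalPrimes_span_finset hmin
  rw [hM, Polynomial.height_map_C, ← hd] at hle
  have h1 : s.card ≤ Fintype.card ι - 1 := by
    refine Finset.card_image_le.trans ?_
    rw [Finset.card_erase_of_mem (Finset.mem_univ _), Finset.card_univ]
  have h2 : Fintype.card ι ≤ s.card := by exact_mod_cast hle
  have h3 : 0 < Fintype.card ι := Fintype.card_pos_iff.2 ⟨i₀⟩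
  omega

open IsLocalRing in
lemma aux_pow {R : Type*} [CommRing R] [IsLocalRing R] (hreg : IsRegularLocal R)
    {f : R} {t d : ℕ} (hf : f ∈ maximalIdeal R ^ t) (hfd : f ^ d ∈ maximalIdeal R ^ (t * d + 1)) :
    f ∈ maximalIdeal R ^ (t + 1) := by
  obtain ⟨hN, s, hs, hcard⟩ := hreg
  let x : s → R := Subtype.val
  have hx : Ideal.span (Set.range x) = maximalIdeal R := by
    rw [← hs]; congr 1; simp [x]
  have hd : (Fintype.card s : ℕ∞) = (maximalIdeal R).height := by
    rw [← maximalIdeal_height_eq_ringKrullDim] at hcard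
    rw [Fintype.card_coe]
    exact WithBot.coe_injective hcard
  rw [← hx] at hf hfd
  obtain ⟨F, hF, rfl⟩ := (Ideal.mem_span_pow_iff_exists_isHomogeneous x _).1 hf
  obtain ⟨G, hG, hGe⟩ := (Ideal.mem_span_pow_iff_exists_isHomogeneous x _).1 hfd
  have h := aux_key x hx hd (hF.pow d) hG (by rw [map_pow, hGe])
  rw [map_pow] at h
  have h0 : MvPolynomial.map (residue R) F = 0 := eq_zero_of_pow_eq_zero h
  rw [MvPolynomial.eval_eq]
  refine Ideal.sum_mem _ fun a ha => ?_
  have hc : F.coeff a ∈ maximalIdeal R := by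
    rw [← residue_eq_zero_iff, ← MvPolynomial.coeff_map, h0, MvPolynomial.coeff_zero]
  have hw := hF (MvPolynomial.mem_support_iff.mp ha)
  simp only [Finsupp.weight_apply, Pi.one_apply, smul_eq_mul, mul_one, Finsupp.sum] at hw
  rw [pow_succ']
  refine Ideal.mul_mem_mul hc ?_
  rw [← hw, ← Finset.prod_pow_eq_pow_sum]
  exact Ideal.prod_mem_prod fun i _ => Ideal.pow_mem_pow (hx ▸ Ideal.subset_span ⟨i, rfl⟩) _

lemma aux_eqn_s13 {R : Type*} [CommRing R] (I : ℕ → Ideal R) (G : Subalgebra R (Polynomial R))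
    (hG : ∀ p, p ∈ G ↔ ∀ n : ℕ, p.coeff n ∈ I n) (f : R) (n : ℕ)
    (h : IsIntegral G (Polynomial.monomial n f)) :
    ∃ (d : ℕ) (a : ℕ → R), (∀ j, a j ∈ I (n * (d - j))) ∧
      f ^ d + ∑ j ∈ Finset.range d, a j * f ^ j = 0 := by
  obtain ⟨p, hp, hp0⟩ := h
  refine ⟨p.natDegree, fun j => (p.coeff j : Polynomial R).coeff (n * (p.natDegree - j)),
    fun j => (hG _).1 (p.coeff j).2 _, ?_⟩
  rw [Polynomial.eval₂_eq_sum_range] at hp0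
  have := congrArg (fun q : Polynomial R => q.coeff (n * p.natDegree)) hp0
  simp only [Polynomial.finsetSum_coeff, Polynomial.coeff_zero] at this
  rw [Finset.sum_range_succ, add_comm] at this
  rw [← this]
  congr 1
  · rw [hp.coeff_natDegree, map_one, one_mul, Polynomial.monomial_pow, Polynomial.coeff_monomial,
      if_pos rfl]
  · refine Finset.sum_congr rfl fun j hj => ?_
    have hj' : j ≤ p.natDegree := (Finset.mem_range.1 hj).le
    rw [Polynomial.monomial_pow]
    have e : n * p.natDegree = n * (p.natDegree - j) + n * j := by
      rw [← mul_add, Nat.sub_add_cancel hj']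
    rw [e, Polynomial.coeff_mul_monomial]
    rfl

lemma aux_lt_order {R : Type*} [CommRing R] [IsLocalRing R] {J : Ideal R} {t : ℕ}
    (h : (t : ℝ≥0∞) < mAdicOrder J) : J ≤ IsLocalRing.maximalIdeal R ^ (t + 1) := by
  unfold mAdicOrder at h
  simp only [lt_iSup_iff] at h
  obtain ⟨u, hu, hlt⟩ := h
  have : t < u := by exact_mod_cast hlt
  exact le_trans hu (Ideal.pow_le_pow_right this)

lemma aux_le_order {R : Type*} [CommRing R] [IsLocalRing R] {J : Ideal R} {t : ℕ}
    (h : J ≤ IsLocalRing.maximalIdeal R ^ t) : (t : ℝ≥0∞) ≤ mAdicOrder J :=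
  le_iSup₂_of_le t h le_rfl

lemma aux_mono {R : Type*} [CommRing R] [IsLocalRing R] {J K : Ideal R}
    (h : J ≤ K) : mAdicOrder K ≤ mAdicOrder J :=
  iSup₂_le fun _ ht => aux_le_order (h.trans ht)

/-- Let `(R, m)` be a regular local ring and `(I¹ₙ)`, `(I²ₙ)` Rees
families on `R` with `I¹ₙ ⊆ I²ₙ`, with associated subalgebras `G₁ ⊆ G₂ ⊆ R[W]`.  If every
element of `G₂` is integral over `G₁` and `ν(I¹ₙ) ≥ n` for every `n` (the closed point is a
singular point), then `inf_{n ≥ 1} ν(I¹ₙ)/n = inf_{n ≥ 1} ν(I²ₙ)/n` in `[0, ∞]`: two Rees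
algebras with the same integral closure have the same order at any singular point. -/
theorem ord_eq_of_integral_rees_families {R : Type*} [CommRing R] [IsLocalRing R]
    (hreg : IsRegularLocal R)
    (I₁ I₂ : ℕ → Ideal R)
    (hI₁0 : I₁ 0 = ⊤) (hI₁mul : ∀ k l : ℕ, I₁ k * I₁ l ≤ I₁ (k + l))
    (hI₂0 : I₂ 0 = ⊤) (hI₂mul : ∀ k l : ℕ, I₂ k * I₂ l ≤ I₂ (k + l))
    (hsub : ∀ n : ℕ, I₁ n ≤ I₂ n)
    (G₁ G₂ : Subalgebra R (Polynomial R))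
    (hG₁ : ∀ p, p ∈ G₁ ↔ ∀ n : ℕ, p.coeff n ∈ I₁ n)
    (hG₂ : ∀ p, p ∈ G₂ ↔ ∀ n : ℕ, p.coeff n ∈ I₂ n)
    (hint : ∀ x ∈ G₂, IsIntegral ↥G₁ x)
    (hsing : ∀ n : ℕ, ((n : ℕ) : ℝ≥0∞) ≤ mAdicOrder (I₁ n)) :
    (⨅ n : {n : ℕ // 1 ≤ n}, mAdicOrder (I₁ n) / ((n : ℕ) : ℝ≥0∞)) =
      ⨅ n : {n : ℕ // 1 ≤ n}, mAdicOrder (I₂ n) / ((n : ℕ) : ℝ≥0∞) := by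
  apply le_antisymm
  · set ω := ⨅ n : {n : ℕ // 1 ≤ n}, mAdicOrder (I₁ n) / ((n : ℕ) : ℝ≥0∞) with hω
    have hωk : ∀ k : ℕ, ω * k ≤ mAdicOrder (I₁ k) := by
      intro k
      rcases Nat.eq_zero_or_pos k with rfl | hk
      · simp
      · exact ENNReal.mul_le_of_le_div (iInf_le _ (⟨k, hk⟩ : {n : ℕ // 1 ≤ n}))
    refine le_iInf ?_
    rintro ⟨n, hn⟩
    simp only
    rw [ENNReal.le_div_iff_mul_le (Or.inl (by exact_mod_cast (by omega : n ≠ 0)))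
      (Or.inl (ENNReal.natCast_ne_top n))]
    have step : ∀ t : ℕ, (t : ℝ≥0∞) < ω * n → I₂ n ≤ IsLocalRing.maximalIdeal R ^ (t + 1) := by
      have main : ∀ t : ℕ, (t : ℝ≥0∞) < ω * n → I₂ n ≤ IsLocalRing.maximalIdeal R ^ t →
          I₂ n ≤ IsLocalRing.maximalIdeal R ^ (t + 1) := by
        intro t ht hle f hf
        have hmem : Polynomial.monomial n f ∈ G₂ := by
          rw [hG₂]
          intro k
          rw [Polynomial.coeff_monomial]
          split_ifs with h
          · exact h ▸ hf
          · exact zero_mem _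
        obtain ⟨d, a, ha, heq⟩ := aux_eqn_s13 I₁ G₁ hG₁ f n (hint _ hmem)
        refine aux_pow hreg (d := d) (hle hf) ?_
        rw [eq_neg_of_add_eq_zero_left heq]
        refine neg_mem (Ideal.sum_mem _ fun j hj => ?_)
        have hj' := Finset.mem_range.1 hj
        have hpos : ((d - j : ℕ) : ℝ≥0∞) ≠ 0 := by exact_mod_cast (by omega : d - j ≠ 0)
        have hlt : ((t * (d - j) : ℕ) : ℝ≥0∞) < mAdicOrder (I₁ (n * (d - j))) := by
          refine lt_of_lt_of_le ?_ (hωk _)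
          rw [Nat.cast_mul, Nat.cast_mul, ← mul_assoc]
          exact ENNReal.mul_lt_mul_left hpos (ENNReal.natCast_ne_top _) ht
        have h1 := aux_lt_order hlt (ha j)
        have h2 : f ^ j ∈ IsLocalRing.maximalIdeal R ^ (t * j) := by
          rw [pow_mul]; exact Ideal.pow_mem_pow (hle hf) j
        have h3 := Ideal.mul_mem_mul h1 h2
        rw [← pow_add] at h3
        have e : t * (d - j) + 1 + t * j = t * d + 1 := by
          have : t * (d - j) + t * j = t * d := by rw [← mul_add, Nat.sub_add_cancel hj'.le]
          omega
        rwa [e] at h3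
      intro t
      induction t with
      | zero => intro ht; exact main 0 ht (by simp)
      | succ t ih =>
        intro ht
        exact main _ ht (ih (lt_of_le_of_lt (by exact_mod_cast Nat.le_succ t) ht))
    by_contra! hlt
    obtain ⟨r, hr⟩ := ENNReal.exists_nat_gt hlt.ne_top
    classical
    have hex : ∃ r : ℕ, mAdicOrder (I₂ n) < r := ⟨r, hr⟩
    have hspec := Nat.find_spec hex
    rcases hm : Nat.find hex with _ | u
    · rw [hm] at hspec; simp at hspec
    · rw [hm] at hspec
      have h1 : ¬ mAdicOrder (I₂ n) < (u : ℝ≥0∞) := Nat.find_min hex (by omega)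
      have h2 := aux_le_order (step u (lt_of_le_of_lt (not_lt.1 h1) hlt))
      exact absurd hspec (not_lt.2 h2)
  · exact iInf_mono fun n => ENNReal.div_le_div_right (aux_mono (hsub n)) _
end
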